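/- arXiv:2101.12566 — 2 statements merged into one kernel-verified Lean document; each statement's English description precedes it below -/
import Mathlib

section
/- For every L²-normalized minimizing sequence ψ_n of the torus Pekar functional E_L on a fixed torus 𝕋³_L (L ≥ L₀), there exists a subsequence converging strongly in H¹(𝕋³_L) to a normalized minimizer ψ of E_L. In particular the Pekar energy e_L = inf E_L is attained. -/
open scoped Real BigOperators Topology

abbrev Lat3 := Fin 3 → ℤ

noncomputable def knorm (L : ℝ) (k : Lat3) : ℝ :=
  (2 * Real.pi / L) * Real.sqrt (∑ i, ((k i : ℝ)) ^ 2)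

noncomputable def rhoCoef (L : ℝ) (ψ : Lat3 → ℂ) (k : Lat3) : ℂ :=
  ((L ^ (-(3:ℝ)/2) : ℝ) : ℂ) * ∑' j : Lat3, (starRingEnd ℂ) (ψ j) * ψ (j + k)

noncomputable def TL (L : ℝ) (ψ : Lat3 → ℂ) : ℝ :=
  ∑' k : Lat3, knorm L k ^ 2 * ‖ψ k‖ ^ 2

noncomputable def WL (L : ℝ) (ψ : Lat3 → ℂ) : ℝ :=
  ∑' k : Lat3, if k = 0 then 0 else ‖rhoCoef L ψ k‖ ^ 2 / knorm L k ^ 2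

noncomputable def EL (L : ℝ) (ψ : Lat3 → ℂ) : ℝ := TL L ψ - WL L ψ

/-- Admissible states: `L²`-normalized functions in `H¹(𝕋³_L)` with finite interaction. -/
def Adm (L : ℝ) (ψ : Lat3 → ℂ) : Prop :=
  (∑' j : Lat3, ‖ψ j‖ ^ 2) = 1 ∧
  Summable (fun k : Lat3 => (1 + knorm L k ^ 2) * ‖ψ k‖ ^ 2) ∧
  (∀ k : Lat3, Summable (fun j : Lat3 => (starRingEnd ℂ) (ψ j) * ψ (j + k))) ∧
  Summable (fun k : Lat3 => if k = 0 then (0:ℝ) else ‖rhoCoef L ψ k‖ ^ 2 / knorm L k ^ 2)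

/-- The Pekar energy `e_L = inf { E_L(ψ) : ψ admissible }`. -/
noncomputable def pekarEnergy (L : ℝ) : ℝ :=
  sInf (EL L '' {ψ : Lat3 → ℂ | Adm L ψ})

/-- Squared `H¹(𝕋³_L)` distance. -/
noncomputable def H1distSq (L : ℝ) (ψ φ : Lat3 → ℂ) : ℝ :=
  ∑' k : Lat3, (1 + knorm L k ^ 2) * ‖ψ k - φ k‖ ^ 2

open Filter

lemma summable_and_tsum_le_of_tendsto {ι : Type*} {f : ℕ → ι → ℝ} {g : ι → ℝ} {b : ℕ → ℝ} {B : ℝ}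
    (h0 : ∀ n i, 0 ≤ f n i) (hs : ∀ n, Summable (f n)) (hb : ∀ n, ∑' i, f n i ≤ b n)
    (hB : Tendsto b atTop (𝓝 B)) (hfg : ∀ i, Tendsto (fun n => f n i) atTop (𝓝 (g i))) :
    Summable g ∧ ∑' i, g i ≤ B := by
  have hg : 0 ≤ g := fun i => ge_of_tendsto' (hfg i) fun n => h0 n i
  have hsum : ∀ s : Finset ι, ∑ i ∈ s, g i ≤ B := fun s =>
    le_of_tendsto_of_tendsto' (tendsto_finsetSum s fun i _ => hfg i) hB fun n =>
      ((hs n).sum_le_tsum s fun i _ => h0 n i).trans (hb n)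
  exact ⟨summable_of_sum_le hg hsum, Real.tsum_le_of_sum_le hg hsum⟩

lemma tendsto_tsum_of_weighted_bound {ι E : Type*} [NormedAddCommGroup E] [CompleteSpace E]
    {w : ι → ℝ} (hw1 : ∀ i, 1 ≤ w i) (hw : Tendsto w cofinite atTop)
    {f : ℕ → ι → E} {g : ι → E} {M : ℝ}
    (hs : ∀ n, Summable fun i => w i * ‖f n i‖) (hM : ∀ n, ∑' i, w i * ‖f n i‖ ≤ M)
    (hfg : ∀ i, Tendsto (fun n => f n i) atTop (𝓝 (g i))) :
    Tendsto (fun n => ∑' i, f n i) atTop (𝓝 (∑' i, g i)) := by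
  classical
  have hw0 : ∀ i, 0 ≤ w i := fun i => zero_le_one.trans (hw1 i)
  obtain ⟨hsg, hMg⟩ := summable_and_tsum_le_of_tendsto
    (fun n i => mul_nonneg (hw0 i) (norm_nonneg (f n i))) hs hM tendsto_const_nhds
    fun i => (hfg i).norm.const_mul (w i)
  have key : ∀ u : ι → E, Summable (fun i => w i * ‖u i‖) → Summable u := fun u hu =>
    .of_norm_bounded hu fun i => le_mul_of_one_le_left (norm_nonneg _) (hw1 i)
  have hM0 : 0 ≤ M := (tsum_nonneg fun i => mul_nonneg (hw0 i) (norm_nonneg _)).trans (hM 0)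
  rw [Metric.tendsto_atTop']
  intro ε hε
  obtain ⟨δ, hδ, hδM⟩ : ∃ δ : ℝ, 0 < δ ∧ 2 * δ * M < ε / 2 := by
    refine ⟨ε / (8 * (M + 1)), by positivity, ?_⟩
    rw [show 2 * (ε / (8 * (M + 1))) * M = (ε / 4) * (M / (M + 1)) by field_simp; ring]
    have : M / (M + 1) ≤ 1 := by rw [div_le_one (by positivity)]; linarith
    nlinarith
  have hfin : {i | ¬ 1 / δ ≤ w i}.Finite := hw.eventually (eventually_ge_atTop (1 / δ))
  set s := hfin.toFinset with hsdef
  have hlim : Tendsto (fun n => ∑ i ∈ s, ‖f n i - g i‖) atTop (𝓝 0) := by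
    simpa using tendsto_finsetSum s fun i _ =>
      (tendsto_iff_norm_sub_tendsto_zero.1 (hfg i))
  obtain ⟨N, hN⟩ := eventually_atTop.1 (hlim.eventually (gt_mem_nhds (half_pos hε)))
  refine ⟨N, fun n hn => ?_⟩
  have hb : ∀ i, ‖f n i - g i‖ ≤
      (if i ∈ s then ‖f n i - g i‖ else 0) + δ * (w i * ‖f n i‖ + w i * ‖g i‖) := by
    intro i
    have h1 := norm_nonneg (f n i)
    have h2 := norm_nonneg (g i)
    split_ifs with hi
    · have := hw0 i
      have : 0 ≤ δ * (w i * ‖f n i‖ + w i * ‖g i‖) := by positivity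
      linarith
    · have hi' : 1 ≤ w i * δ := by
        have : 1 / δ ≤ w i := by simpa [hsdef] using hi
        rwa [div_le_iff₀ hδ] at this
      have := norm_sub_le (f n i) (g i)
      nlinarith
  have hs1 : Summable fun i => if i ∈ s then ‖f n i - g i‖ else 0 :=
    summable_of_ne_finset_zero (s := s) fun i hi => by simp [hi]
  have hs2 := ((hs n).add hsg).mul_left δ
  rw [dist_eq_norm, ← (key _ (hs n)).tsum_sub (key _ hsg)]
  calc ‖∑' i, (f n i - g i)‖
      ≤ _ := tsum_of_norm_bounded (hs1.add hs2).hasSum hb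
    _ = ∑ i ∈ s, ‖f n i - g i‖ + δ * (∑' i, w i * ‖f n i‖ + ∑' i, w i * ‖g i‖) := by
        rw [hs1.tsum_add hs2, tsum_mul_left, (hs n).tsum_add hsg,
          tsum_eq_sum (s := s) fun i hi => by simp [hi]]
        congr 1
        exact Finset.sum_congr rfl fun i hi => by simp [hi]
    _ < ε := by
        have := hN n hn.le
        have := hM n
        nlinarith

lemma norm_sub_sq_le {E : Type*} [SeminormedAddCommGroup E] (x y : E) :
    ‖x - y‖ ^ 2 ≤ 2 * ‖x‖ ^ 2 + 2 * ‖y‖ ^ 2 := by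
  have h := norm_sub_le x y
  have h0 := norm_nonneg (x - y)
  nlinarith [sq_nonneg (‖x‖ - ‖y‖)]

lemma summable_mul_norm_sub_sq {ι E : Type*} [SeminormedAddCommGroup E] {w : ι → ℝ}
    (hw : ∀ i, 0 ≤ w i) {f g : ι → E} (hf : Summable fun i => w i * ‖f i‖ ^ 2)
    (hg : Summable fun i => w i * ‖g i‖ ^ 2) : Summable fun i => w i * ‖f i - g i‖ ^ 2 := by
  refine .of_nonneg_of_le (fun i => mul_nonneg (hw i) (sq_nonneg _)) (fun i => ?_)
    ((hf.mul_left 2).add (hg.mul_left 2))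
  nlinarith [mul_le_mul_of_nonneg_left (norm_sub_sq_le (f i) (g i)) (hw i)]

/-- Pointwise convergence and convergence of weighted `ℓ²` norms imply strong convergence. -/
lemma tendsto_tsum_mul_norm_sub_sq {ι E : Type*} [SeminormedAddCommGroup E] {w : ι → ℝ}
    (hw : ∀ i, 0 ≤ w i) {f : ℕ → ι → E} {g : ι → E}
    (hf : ∀ n, Summable fun i => w i * ‖f n i‖ ^ 2) (hg : Summable fun i => w i * ‖g i‖ ^ 2)
    (hfg : ∀ i, Tendsto (fun n => f n i) atTop (𝓝 (g i)))
    (hlim : Tendsto (fun n => ∑' i, w i * ‖f n i‖ ^ 2) atTop (𝓝 (∑' i, w i * ‖g i‖ ^ 2))) :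
    Tendsto (fun n => ∑' i, w i * ‖f n i - g i‖ ^ 2) atTop (𝓝 0) := by
  set S := ∑' i, w i * ‖g i‖ ^ 2 with hS
  refine tendsto_order.2 ⟨fun a ha => .of_forall fun n => ha.trans_le
    (tsum_nonneg fun i => mul_nonneg (hw i) (sq_nonneg _)), fun ε hε => ?_⟩
  obtain ⟨s, hs⟩ := (hg.hasSum.eventually (lt_mem_nhds (show S - ε / 8 < S by linarith))).exists
  let G : ℕ → ι → ℝ := fun n i =>
    2 * (w i * ‖f n i‖ ^ 2) + 2 * (w i * ‖g i‖ ^ 2) - w i * ‖f n i - g i‖ ^ 2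
  have hG : Tendsto (fun n => ∑ i ∈ s, G n i) atTop (𝓝 (∑ i ∈ s, 4 * (w i * ‖g i‖ ^ 2))) := by
    refine tendsto_finsetSum s fun i _ => ?_
    have h1 := (((hfg i).norm.pow 2).const_mul (w i)).const_mul 2
    have h2 := ((tendsto_iff_norm_sub_tendsto_zero.1 (hfg i)).pow 2).const_mul (w i)
    convert (h1.add_const (2 * (w i * ‖g i‖ ^ 2))).sub h2 using 2
    ring
  rw [← Finset.mul_sum] at hG
  have e1 := hG.eventually (lt_mem_nhds (show 4 * S - ε / 2 < _ by linarith))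
  have e2 := hlim.eventually (gt_mem_nhds (show S < S + ε / 4 by linarith))
  filter_upwards [e1, e2] with n h1 h2
  have hsub := summable_mul_norm_sub_sq hw (hf n) hg
  have hsG := (((hf n).mul_left 2).add (hg.mul_left 2)).sub hsub
  have h3 : ∑ i ∈ s, G n i ≤ ∑' i, G n i := hsG.sum_le_tsum s fun i _ => by
    nlinarith [mul_le_mul_of_nonneg_left (norm_sub_sq_le (f n i) (g i)) (hw i)]
  have h4 : ∑' i, G n i = 2 * ∑' i, w i * ‖f n i‖ ^ 2 + 2 * S - ∑' i, w i * ‖f n i - g i‖ ^ 2 := by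
    rw [Summable.tsum_sub (((hf n).mul_left 2).add (hg.mul_left 2)) hsub,
      ((hf n).mul_left 2).tsum_add (hg.mul_left 2), tsum_mul_left, tsum_mul_left]
  linarith

lemma knorm_nonneg {L : ℝ} (hL : 0 < L) (k : Lat3) : 0 ≤ knorm L k := by
  unfold knorm; positivity

lemma knorm_eq_norm {L : ℝ} (k : Lat3) :
    knorm L k = (2 * Real.pi / L) * ‖WithLp.toLp 2 (fun i => (k i : ℝ))‖ := by
  simp [knorm, EuclideanSpace.norm_eq]

lemma knorm_le_add {L : ℝ} (hL : 0 < L) (j k : Lat3) :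
    knorm L k ≤ knorm L j + knorm L (j + k) := by
  rw [knorm_eq_norm, knorm_eq_norm, knorm_eq_norm, ← mul_add]
  have : WithLp.toLp 2 (fun i => (k i : ℝ)) =
      WithLp.toLp 2 (fun i => ((j + k) i : ℝ)) - WithLp.toLp 2 (fun i => (j i : ℝ)) := by
    ext i; simp
  gcongr
  rw [this]
  exact (norm_sub_le (E := EuclideanSpace ℝ (Fin 3)) _ _).trans_eq (add_comm _ _)

lemma mul_norm_le_knorm {L : ℝ} (hL : 0 < L) (k : Lat3) :
    (2 * Real.pi / L) * ‖k‖ ≤ knorm L k := by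
  unfold knorm
  gcongr
  refine (pi_norm_le_iff_of_nonneg (Real.sqrt_nonneg _)).2 fun i => ?_
  rw [Int.norm_eq_abs]
  refine Real.abs_le_sqrt ?_
  exact Finset.single_le_sum (f := fun i => (k i : ℝ) ^ 2) (fun i _ => sq_nonneg _)
    (Finset.mem_univ i)

lemma knorm_pos {L : ℝ} (hL : 0 < L) {k : Lat3} (hk : k ≠ 0) : 0 < knorm L k := by
  have := norm_pos_iff.2 hk
  have := Real.pi_pos
  exact lt_of_lt_of_le (by positivity) (mul_norm_le_knorm hL k)

lemma tendsto_knorm {L : ℝ} (hL : 0 < L) : Tendsto (knorm L) cofinite atTop := by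
  have h : Tendsto (fun k : Lat3 => ‖k‖) cofinite atTop := by
    rw [← cocompact_eq_cofinite]
    exact tendsto_norm_cocompact_atTop
  have := Real.pi_pos
  exact tendsto_atTop_mono (mul_norm_le_knorm hL) (h.const_mul_atTop (by positivity))

lemma summable_norm_inv_pow_four : Summable fun k : Lat3 => ‖k‖⁻¹ ^ 4 := by
  let b := Pi.basisFun ℝ (Fin 3)
  let Λ := Submodule.span ℤ (Set.range b)
  have hr : Module.finrank ℤ Λ < 4 :=
    (finrank_range_le_card (R := ℤ) (b := b)).trans_lt (by simp)
  have h := ZLattice.summable_norm_pow_inv Λ 4 hr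
  have hmem : ∀ k : Lat3, (fun i => (k i : ℝ)) ∈ Λ := fun k => by
    rw [Module.Basis.mem_span_iff_repr_mem]
    intro i
    exact ⟨k i, by simp [b]⟩
  have hinj : Function.Injective fun k : Lat3 => (⟨fun i => (k i : ℝ), hmem k⟩ : Λ) := by
    intro k l hkl
    ext i
    exact Int.cast_injective (congrFun (Subtype.ext_iff.1 hkl) i)
  refine (h.comp_injective hinj).congr fun k => ?_
  have : ‖fun i => (k i : ℝ)‖ = ‖k‖ := by
    simp only [Pi.norm_def]
    rfl
  simp [this]

lemma summable_inv_knorm_pow_four {L : ℝ} (hL : 0 < L) :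
    Summable fun k : Lat3 => (knorm L k ^ 4)⁻¹ := by
  have := Real.pi_pos
  refine .of_nonneg_of_le (fun k => inv_nonneg.2 (pow_nonneg (knorm_nonneg hL k) 4)) (fun k => ?_)
    (summable_norm_inv_pow_four.mul_left ((2 * Real.pi / L) ^ 4)⁻¹)
  by_cases hk : k = 0
  · simp [hk, knorm]
  have hk' := norm_pos_iff.2 hk
  rw [inv_pow, ← mul_inv, ← mul_pow]
  gcongr
  exact mul_norm_le_knorm hL k

lemma summable_norm_sq_of_H1 {L : ℝ} {ψ : Lat3 → ℂ}
    (h : Summable fun k => (1 + knorm L k ^ 2) * ‖ψ k‖ ^ 2) : Summable fun k => ‖ψ k‖ ^ 2 :=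
  .of_nonneg_of_le (fun _ => sq_nonneg _)
    (fun k => le_mul_of_one_le_left (sq_nonneg _) (by linarith [sq_nonneg (knorm L k)])) h

lemma summable_knorm_sq_mul_of_H1 {L : ℝ} {ψ : Lat3 → ℂ}
    (h : Summable fun k => (1 + knorm L k ^ 2) * ‖ψ k‖ ^ 2) :
    Summable fun k => knorm L k ^ 2 * ‖ψ k‖ ^ 2 :=
  .of_nonneg_of_le (fun _ => by positivity)
    (fun k => mul_le_mul_of_nonneg_right (by linarith) (sq_nonneg _)) h

lemma tsum_H1_eq {L : ℝ} {ψ : Lat3 → ℂ}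
    (h : Summable fun k => (1 + knorm L k ^ 2) * ‖ψ k‖ ^ 2) :
    ∑' k, (1 + knorm L k ^ 2) * ‖ψ k‖ ^ 2 = ∑' k, ‖ψ k‖ ^ 2 + TL L ψ := by
  rw [TL, ← (summable_norm_sq_of_H1 h).tsum_add (summable_knorm_sq_mul_of_H1 h)]
  exact tsum_congr fun k => by ring

lemma summable_shift {f : Lat3 → ℝ} (h : Summable f) (k : Lat3) : Summable fun j => f (j + k) :=
  (Equiv.addRight k).summable_iff.2 h

lemma tsum_shift (f : Lat3 → ℝ) (k : Lat3) : ∑' j, f (j + k) = ∑' j, f j :=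
  (Equiv.addRight k).tsum_eq f

lemma norm_correlation_le (ψ : Lat3 → ℂ) (j k : Lat3) :
    ‖(starRingEnd ℂ) (ψ j) * ψ (j + k)‖ ≤ (‖ψ j‖ ^ 2 + ‖ψ (j + k)‖ ^ 2) / 2 := by
  rw [norm_mul, RCLike.norm_conj]
  linarith [two_mul_le_add_sq ‖ψ j‖ ‖ψ (j + k)‖]

lemma summable_norm_correlation {ψ : Lat3 → ℂ} (h : Summable fun k => ‖ψ k‖ ^ 2) (k : Lat3) :
    Summable fun j => ‖(starRingEnd ℂ) (ψ j) * ψ (j + k)‖ :=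
  .of_nonneg_of_le (fun _ => norm_nonneg _) (fun j => norm_correlation_le ψ j k)
    ((h.add (summable_shift h k)).div_const 2)

lemma norm_rhoCoef_le_mul_tsum {L : ℝ} (hL : 0 < L) {ψ : Lat3 → ℂ}
    (h : Summable fun k => ‖ψ k‖ ^ 2) (k : Lat3) :
    ‖rhoCoef L ψ k‖ ≤
      L ^ (-(3 : ℝ) / 2) * ∑' j, ‖(starRingEnd ℂ) (ψ j) * ψ (j + k)‖ := by
  rw [rhoCoef, norm_mul, Complex.norm_of_nonneg (by positivity)]
  gcongr
  exact norm_tsum_le_tsum_norm (summable_norm_correlation h k)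

lemma norm_rhoCoef_le {L : ℝ} (hL : 0 < L) {ψ : Lat3 → ℂ}
    (h : Summable fun k => ‖ψ k‖ ^ 2) (h1 : ∑' k, ‖ψ k‖ ^ 2 = 1) (k : Lat3) :
    ‖rhoCoef L ψ k‖ ≤ L ^ (-(3 : ℝ) / 2) := by
  refine (norm_rhoCoef_le_mul_tsum hL h k).trans (mul_le_of_le_one_right (by positivity) ?_)
  refine ((summable_norm_correlation h k).tsum_le_tsum (fun j => norm_correlation_le ψ j k)
    ((h.add (summable_shift h k)).div_const 2)).trans_eq ?_
  rw [tsum_div_const, h.tsum_add (summable_shift h k), tsum_shift (fun j => ‖ψ j‖ ^ 2), h1]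
  norm_num

lemma TL_nonneg (L : ℝ) (ψ : Lat3 → ℂ) : 0 ≤ TL L ψ := tsum_nonneg fun _ => by positivity

/-- The `Ḣ¹`-type bound on density coefficients, from the triangle inequality in frequency and
the Cauchy–Schwarz inequality. -/
lemma knorm_mul_norm_rhoCoef_le {L : ℝ} (hL : 0 < L) {ψ : Lat3 → ℂ}
    (h : Summable fun k => (1 + knorm L k ^ 2) * ‖ψ k‖ ^ 2) (h1 : ∑' k, ‖ψ k‖ ^ 2 = 1)
    (k : Lat3) :
    knorm L k * ‖rhoCoef L ψ k‖ ≤ L ^ (-(3 : ℝ) / 2) * (2 * √(TL L ψ + 1)) := by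
  have h0 := summable_norm_sq_of_H1 h
  have hT := summable_knorm_sq_mul_of_H1 h
  have hK := knorm_nonneg hL
  have hTL := TL_nonneg L ψ
  set r := √(TL L ψ + 1) with hr
  have hr0 : 0 < r := Real.sqrt_pos.2 (by linarith)
  have hr2 : r ^ 2 = TL L ψ + 1 := Real.sq_sqrt (by linarith)
  have young : ∀ a x y : ℝ, a * x * y ≤ (r⁻¹ * (a ^ 2 * x ^ 2) + r * y ^ 2) / 2 := by
    intro a x y
    have : r⁻¹ * (a ^ 2 * x ^ 2) + r * y ^ 2 - 2 * (a * x * y) = r⁻¹ * (a * x - r * y) ^ 2 := by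
      field_simp
      ring
    have : 0 ≤ r⁻¹ * (a * x - r * y) ^ 2 := by positivity
    linarith
  let F : Lat3 → ℝ := fun j => r⁻¹ * (knorm L j ^ 2 * ‖ψ j‖ ^ 2) + r * ‖ψ j‖ ^ 2
  have hF : Summable F := (hT.mul_left r⁻¹).add (h0.mul_left r)
  have hFs : ∑' j, F j ≤ 2 * r := by
    rw [(hT.mul_left r⁻¹).tsum_add (h0.mul_left r), tsum_mul_left, tsum_mul_left, h1]
    change r⁻¹ * TL L ψ + r * 1 ≤ 2 * r
    have : r⁻¹ * TL L ψ ≤ r⁻¹ * r ^ 2 := by gcongr; linarith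
    have : r⁻¹ * r ^ 2 = r := by field_simp
    linarith
  have hterm : ∀ j, knorm L k * ‖(starRingEnd ℂ) (ψ j) * ψ (j + k)‖ ≤ (F j + F (j + k)) / 2 := by
    intro j
    rw [norm_mul, RCLike.norm_conj]
    have a1 := young (knorm L j) ‖ψ j‖ ‖ψ (j + k)‖
    have a2 := young (knorm L (j + k)) ‖ψ (j + k)‖ ‖ψ j‖
    have a3 : knorm L k * (‖ψ j‖ * ‖ψ (j + k)‖) ≤
        (knorm L j + knorm L (j + k)) * (‖ψ j‖ * ‖ψ (j + k)‖) := by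
      gcongr
      exact knorm_le_add hL j k
    simp only [F]
    linarith
  have hsum : knorm L k * ∑' j, ‖(starRingEnd ℂ) (ψ j) * ψ (j + k)‖ ≤ 2 * r := by
    rw [← tsum_mul_left]
    refine (((summable_norm_correlation h0 k).mul_left _).tsum_le_tsum hterm
      ((hF.add (summable_shift hF k)).div_const 2)).trans ?_
    rw [tsum_div_const, hF.tsum_add (summable_shift hF k), tsum_shift F]
    linarith
  calc knorm L k * ‖rhoCoef L ψ k‖
      ≤ knorm L k * (L ^ (-(3 : ℝ) / 2) * ∑' j, ‖(starRingEnd ℂ) (ψ j) * ψ (j + k)‖) := by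
        gcongr
        · exact hK k
        · exact norm_rhoCoef_le_mul_tsum hL h0 k
    _ = L ^ (-(3 : ℝ) / 2) * (knorm L k * ∑' j, ‖(starRingEnd ℂ) (ψ j) * ψ (j + k)‖) := by ring
    _ ≤ _ := by gcongr

/-- The summand of `WL`. -/
noncomputable def interactionTerm (L : ℝ) (ψ : Lat3 → ℂ) (k : Lat3) : ℝ :=
  if k = 0 then 0 else ‖rhoCoef L ψ k‖ ^ 2 / knorm L k ^ 2

lemma interactionTerm_nonneg (L : ℝ) (ψ : Lat3 → ℂ) (k : Lat3) : 0 ≤ interactionTerm L ψ k := by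
  unfold interactionTerm
  split_ifs <;> positivity

lemma interactionTerm_le {L : ℝ} (hL : 0 < L) {ψ : Lat3 → ℂ}
    (h : Summable fun k => (1 + knorm L k ^ 2) * ‖ψ k‖ ^ 2) (h1 : ∑' k, ‖ψ k‖ ^ 2 = 1)
    (k : Lat3) :
    interactionTerm L ψ k ≤
      4 * (L ^ (-(3 : ℝ) / 2)) ^ 2 * (TL L ψ + 1) * (knorm L k ^ 4)⁻¹ := by
  have hTL := TL_nonneg L ψ
  unfold interactionTerm
  split_ifs with hk
  · positivity
  have hK := knorm_pos hL hk
  have hb := pow_le_pow_left₀ (by positivity) (knorm_mul_norm_rhoCoef_le hL h h1 k) 2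
  rw [mul_pow, mul_pow, mul_pow, Real.sq_sqrt (by linarith)] at hb
  rw [← div_eq_mul_inv, div_le_div_iff₀ (by positivity) (by positivity)]
  calc ‖rhoCoef L ψ k‖ ^ 2 * knorm L k ^ 4
      = (knorm L k ^ 2 * ‖rhoCoef L ψ k‖ ^ 2) * knorm L k ^ 2 := by ring
    _ ≤ ((L ^ (-(3 : ℝ) / 2)) ^ 2 * (2 ^ 2 * (TL L ψ + 1))) * knorm L k ^ 2 := by gcongr
    _ = _ := by ring

lemma summable_interactionTerm {L : ℝ} (hL : 0 < L) {ψ : Lat3 → ℂ}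
    (h : Summable fun k => (1 + knorm L k ^ 2) * ‖ψ k‖ ^ 2) (h1 : ∑' k, ‖ψ k‖ ^ 2 = 1) :
    Summable (interactionTerm L ψ) :=
  .of_nonneg_of_le (interactionTerm_nonneg L ψ) (interactionTerm_le hL h h1)
    ((summable_inv_knorm_pow_four hL).mul_left _)

lemma adm_of_H1 {L : ℝ} (hL : 0 < L) {ψ : Lat3 → ℂ}
    (h : Summable fun k => (1 + knorm L k ^ 2) * ‖ψ k‖ ^ 2) (h1 : ∑' k, ‖ψ k‖ ^ 2 = 1) :
    Adm L ψ :=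
  ⟨h1, h, fun k => (summable_norm_correlation (summable_norm_sq_of_H1 h) k).of_norm,
    summable_interactionTerm hL h h1⟩

/-- Coercivity of the Pekar functional on normalized states. -/
lemma exists_TL_half_sub_le_EL {L : ℝ} (hL : 0 < L) :
    ∃ C : ℝ, ∀ ψ, Adm L ψ → TL L ψ / 2 - C ≤ EL L ψ := by
  classical
  set c := L ^ (-(3 : ℝ) / 2) with hc
  have hsum := (summable_inv_knorm_pow_four hL).mul_left (4 * c ^ 2)
  obtain ⟨s, hs⟩ := ((tendsto_tsum_compl_atTop_zero fun k : Lat3 =>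
    4 * c ^ 2 * (knorm L k ^ 4)⁻¹).eventually (gt_mem_nhds one_half_pos)).exists
  refine ⟨∑ k ∈ s, c ^ 2 / knorm L k ^ 2 + 1 / 2, fun ψ hψ => ?_⟩
  obtain ⟨h1, h, -, -⟩ := hψ
  have hTL := TL_nonneg L ψ
  have hW := summable_interactionTerm hL h h1
  have hsplit : WL L ψ = ∑ k ∈ s, interactionTerm L ψ k +
      ∑' k : {k // k ∉ s}, interactionTerm L ψ k := (hW.sum_add_tsum_subtype_compl s).symm
  have hlow : ∑ k ∈ s, interactionTerm L ψ k ≤ ∑ k ∈ s, c ^ 2 / knorm L k ^ 2 := by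
    refine Finset.sum_le_sum fun k _ => ?_
    unfold interactionTerm
    split_ifs
    · positivity
    · gcongr
      exact norm_rhoCoef_le hL (summable_norm_sq_of_H1 h) h1 k
  have hhigh : ∑' k : {k // k ∉ s}, interactionTerm L ψ k ≤
      (TL L ψ + 1) * ∑' k : {k // k ∉ s}, 4 * c ^ 2 * (knorm L k ^ 4)⁻¹ := by
    rw [← tsum_mul_left]
    refine (hW.subtype _).tsum_le_tsum (fun k => ?_) ((hsum.subtype _).mul_left _)
    refine (interactionTerm_le hL h h1 k).trans_eq ?_
    ring
  have : (TL L ψ + 1) * ∑' k : {k // k ∉ s}, 4 * c ^ 2 * (knorm L k ^ 4)⁻¹ ≤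
      (TL L ψ + 1) * (1 / 2) := by gcongr
  rw [EL, hsplit]
  linarith

lemma pekarEnergy_le {L : ℝ} (hL : 0 < L) {ψ : Lat3 → ℂ} (h : Adm L ψ) :
    pekarEnergy L ≤ EL L ψ := by
  obtain ⟨C, hC⟩ := exists_TL_half_sub_le_EL hL
  refine csInf_le ⟨-C, ?_⟩ ⟨ψ, h, rfl⟩
  rintro _ ⟨φ, hφ, rfl⟩
  linarith [hC φ hφ, TL_nonneg L φ]

lemma norm_le_one_of_adm {L : ℝ} {ψ : Lat3 → ℂ} (h : Adm L ψ) (k : Lat3) : ‖ψ k‖ ≤ 1 := by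
  have := (summable_norm_sq_of_H1 h.2.1).le_tsum k fun _ _ => sq_nonneg _
  rw [h.1] at this
  exact (sq_le_one_iff₀ (norm_nonneg _)).1 this

lemma tendsto_one_add_knorm_sq {L : ℝ} (hL : 0 < L) :
    Tendsto (fun k => 1 + knorm L k ^ 2) cofinite atTop :=
  tendsto_atTop_add_const_left _ _ ((tendsto_pow_atTop two_ne_zero).comp (tendsto_knorm hL))

lemma tendsto_tsum_norm_sq {L M : ℝ} (hL : 0 < L) {f : ℕ → Lat3 → ℂ} {g : Lat3 → ℂ}
    (hf : ∀ n, Summable fun k => (1 + knorm L k ^ 2) * ‖f n k‖ ^ 2)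
    (hM : ∀ n, ∑' k, (1 + knorm L k ^ 2) * ‖f n k‖ ^ 2 ≤ M)
    (hfg : ∀ k, Tendsto (fun n => f n k) atTop (𝓝 (g k))) :
    Tendsto (fun n => ∑' k, ‖f n k‖ ^ 2) atTop (𝓝 (∑' k, ‖g k‖ ^ 2)) := by
  refine tendsto_tsum_of_weighted_bound (w := fun k => 1 + knorm L k ^ 2) (M := M)
    (fun k => by linarith [sq_nonneg (knorm L k)]) (tendsto_one_add_knorm_sq hL) ?_ ?_
    fun k => (hfg k).norm.pow 2
  · simpa using hf
  · simpa using hM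

lemma tendsto_rhoCoef {L M : ℝ} (hL : 0 < L) {f : ℕ → Lat3 → ℂ} {g : Lat3 → ℂ}
    (hf : ∀ n, Summable fun k => (1 + knorm L k ^ 2) * ‖f n k‖ ^ 2)
    (hM : ∀ n, ∑' k, (1 + knorm L k ^ 2) * ‖f n k‖ ^ 2 ≤ M)
    (hfg : ∀ k, Tendsto (fun n => f n k) atTop (𝓝 (g k))) (k : Lat3) :
    Tendsto (fun n => rhoCoef L (f n) k) atTop (𝓝 (rhoCoef L g k)) := by
  have hw : ∀ j, √(1 + knorm L j ^ 2) ^ 2 = 1 + knorm L j ^ 2 := fun j =>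
    Real.sq_sqrt (by positivity)
  have hle : ∀ n j, √(1 + knorm L j ^ 2) * ‖(starRingEnd ℂ) (f n j) * f n (j + k)‖ ≤
      ((1 + knorm L j ^ 2) * ‖f n j‖ ^ 2 + ‖f n (j + k)‖ ^ 2) / 2 := fun n j => by
    rw [norm_mul, RCLike.norm_conj, ← mul_assoc]
    have := two_mul_le_add_sq (√(1 + knorm L j ^ 2) * ‖f n j‖) ‖f n (j + k)‖
    rw [mul_pow, hw] at this
    linarith
  have h0 := fun n => summable_norm_sq_of_H1 (hf n)
  have hbs := fun n => ((hf n).add (summable_shift (h0 n) k)).div_const 2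
  have hs := fun n => Summable.of_nonneg_of_le (fun j => by positivity) (hle n) (hbs n)
  refine Tendsto.const_mul _ (tendsto_tsum_of_weighted_bound
    (w := fun j => √(1 + knorm L j ^ 2)) (M := M)
    (fun j => Real.one_le_sqrt.2 (by linarith [sq_nonneg (knorm L j)]))
    (Real.tendsto_sqrt_atTop.comp (tendsto_one_add_knorm_sq hL)) hs (fun n => ?_)
    fun j => ((Complex.continuous_conj.tendsto _).comp (hfg j)).mul (hfg (j + k)))
  refine ((hs n).tsum_le_tsum (hle n) (hbs n)).trans ?_
  rw [tsum_div_const, (hf n).tsum_add (summable_shift (h0 n) k),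
    tsum_shift (fun j => ‖f n j‖ ^ 2)]
  have := hM n
  have := tsum_H1_eq (hf n)
  have := TL_nonneg L (f n)
  linarith

lemma tendsto_WL {L M : ℝ} (hL : 0 < L) {f : ℕ → Lat3 → ℂ} {g : Lat3 → ℂ}
    (hf : ∀ n, Adm L (f n)) (hM : ∀ n, TL L (f n) ≤ M)
    (hfg : ∀ k, Tendsto (fun n => f n k) atTop (𝓝 (g k))) :
    Tendsto (fun n => WL L (f n)) atTop (𝓝 (WL L g)) := by
  refine tendsto_tsum_of_dominated_convergence
    (bound := fun k => 4 * (L ^ (-(3 : ℝ) / 2)) ^ 2 * (M + 1) * (knorm L k ^ 4)⁻¹)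
    ((summable_inv_knorm_pow_four hL).mul_left _) (fun k => ?_) (.of_forall fun n k => ?_)
  · split_ifs
    · exact tendsto_const_nhds
    · refine ((tendsto_rhoCoef (M := M + 1) hL (fun n => (hf n).2.1) (fun n => ?_) hfg
        k).norm.pow 2).div_const _
      rw [tsum_H1_eq (hf n).2.1, (hf n).1]
      linarith [hM n]
  · change ‖interactionTerm L (f n) k‖ ≤ _
    rw [Real.norm_of_nonneg (interactionTerm_nonneg _ _ _)]
    refine (interactionTerm_le hL (hf n).2.1 (hf n).1 k).trans ?_
    gcongr
    exact hM n

/-- On a fixed torus `𝕋³_L` with `L ≥ L₀ > 0`, every normalized minimizing sequence of the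
Pekar functional `E_L` has a subsequence converging strongly in `H¹(𝕋³_L)` to a normalized
minimizer; in particular `e_L` is attained. -/
theorem pekar_minimizer_exists :
    ∀ L₀ : ℝ, 0 < L₀ → ∀ L : ℝ, L₀ ≤ L →
      ∀ ψn : ℕ → Lat3 → ℂ,
        (∀ n, Adm L (ψn n)) →
        Filter.Tendsto (fun n => EL L (ψn n)) Filter.atTop (𝓝 (pekarEnergy L)) →
        ∃ σ : ℕ → ℕ, StrictMono σ ∧ ∃ ψ : Lat3 → ℂ,
          Adm L ψ ∧ EL L ψ = pekarEnergy L ∧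
          Filter.Tendsto (fun n => H1distSq L (ψn (σ n)) ψ) Filter.atTop (𝓝 0) := by
  intro L₀ hL₀ L hL₀L ψn hadm hmin
  have hL : 0 < L := hL₀.trans_le hL₀L
  obtain ⟨C, hC⟩ := exists_TL_half_sub_le_EL hL
  obtain ⟨B, hB⟩ := hmin.bddAbove_range
  have hT : ∀ n, TL L (ψn n) ≤ 2 * (B + C) := fun n => by
    linarith [hC _ (hadm n), hB (Set.mem_range_self n)]
  have hcpt : IsCompact (Set.univ.pi fun _ : Lat3 => Metric.closedBall (0 : ℂ) 1) :=
    isCompact_univ_pi fun _ => isCompact_closedBall 0 1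
  obtain ⟨ψ, -, σ, hσ, hlim⟩ := hcpt.tendsto_subseq (x := ψn) fun n k _ => by
    simpa using norm_le_one_of_adm (hadm n) k
  have hpt : ∀ k, Tendsto (fun n => ψn (σ n) k) atTop (𝓝 (ψ k)) := tendsto_pi_nhds.1 hlim
  have hadm' : ∀ n, Adm L (ψn (σ n)) := fun n => hadm _
  have hM : ∀ n, ∑' k, (1 + knorm L k ^ 2) * ‖ψn (σ n) k‖ ^ 2 ≤ 1 + 2 * (B + C) := fun n => by
    rw [tsum_H1_eq (hadm' n).2.1, (hadm' n).1]
    linarith [hT (σ n)]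
  have hnorm : ∑' k, ‖ψ k‖ ^ 2 = 1 := by
    refine tendsto_nhds_unique (tendsto_tsum_norm_sq hL (fun n => (hadm' n).2.1) hM hpt) ?_
    simp only [(hadm' _).1, tendsto_const_nhds_iff]
  have hT' : Tendsto (fun n => TL L (ψn (σ n))) atTop (𝓝 (pekarEnergy L + WL L ψ)) :=
    ((hmin.comp hσ.tendsto_atTop).add (tendsto_WL hL hadm' (fun n => hT _) hpt)).congr
      fun n => by simp [EL]
  have hS' : Tendsto (fun n => ∑' k, (1 + knorm L k ^ 2) * ‖ψn (σ n) k‖ ^ 2) atTop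
      (𝓝 (1 + (pekarEnergy L + WL L ψ))) :=
    (hT'.const_add 1).congr fun n => by rw [tsum_H1_eq (hadm' n).2.1, (hadm' n).1]
  obtain ⟨hH1, hle⟩ := summable_and_tsum_le_of_tendsto (fun n k => by positivity)
    (fun n => (hadm' n).2.1) (fun n => le_rfl) hS' fun k => ((hpt k).norm.pow 2).const_mul _
  have hψ := adm_of_H1 hL hH1 hnorm
  have hE : EL L ψ = pekarEnergy L := by
    refine le_antisymm ?_ (pekarEnergy_le hL hψ)
    rw [tsum_H1_eq hH1, hnorm] at hle
    rw [EL]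
    linarith
  refine ⟨σ, hσ, ψ, hψ, hE, tendsto_tsum_mul_norm_sub_sq (fun k => by positivity)
    (fun n => (hadm' n).2.1) hH1 hpt ?_⟩
  convert hS' using 2
  rw [tsum_H1_eq hH1, hnorm, ← hE, EL]
  ring
end

section
/- For Λ > 1 and any q ∈ (2π/L)ℤ³, the lattice sum Σ_{k∈(2π/L)ℤ³, |k|≥Λ, k≠q} L^{-3} |k|^{-6} |q−k|^{-2} is bounded by C Λ^{-5} for a constant C independent of L ≥ L₀, Λ and q. -/
open scoped Real BigOperators

/-- Bounded sums over `ℕ` bound the sums of the even extension over `ℤ`. -/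
lemma sum_natAbs_le {g : ℕ → ℝ} (hg : ∀ n, 0 ≤ g n) {B : ℝ}
    (hB : ∀ M : ℕ, ∑ n ∈ Finset.range M, g n ≤ B) (t : Finset ℤ) :
    ∑ n ∈ t, g n.natAbs ≤ 2 * B := by
  have key : ∀ u : Finset ℤ, Set.InjOn Int.natAbs (u : Set ℤ) →
      ∑ n ∈ u, g n.natAbs ≤ B := by
    intro u hu
    rw [← Finset.sum_image (f := g) hu]
    refine le_trans ?_ (hB ((u.image Int.natAbs).sup id + 1))
    refine Finset.sum_le_sum_of_subset_of_nonneg (fun n hn => ?_) (fun n _ _ => hg n)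
    exact Finset.mem_range.2 (Nat.lt_succ_of_le (Finset.le_sup (f := id) hn))
  rw [← Finset.sum_filter_add_sum_filter_not t (fun n => 0 ≤ n), two_mul]
  refine add_le_add (key _ ?_) (key _ ?_) <;>
  · intro x hx y hy hxy
    simp only [Finset.coe_filter, Set.mem_ofPred_eq] at hx hy
    omega

lemma sum_prod_le_pow {g : ℤ → ℝ} (hg : ∀ n, 0 ≤ g n) {B : ℝ}
    (hB : ∀ t : Finset ℤ, ∑ n ∈ t, g n ≤ B) (s : Finset Lat3) :
    ∑ k ∈ s, ∏ i, g (k i) ≤ B ^ 3 := by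
  set t : Finset ℤ := s.biUnion fun k => Finset.univ.image k
  have hst : s ⊆ Fintype.piFinset fun _ : Fin 3 => t := by
    intro k hk
    rw [Fintype.mem_piFinset]
    intro i
    exact Finset.mem_biUnion.2 ⟨k, hk, Finset.mem_image_of_mem _ (Finset.mem_univ i)⟩
  calc ∑ k ∈ s, ∏ i, g (k i)
      ≤ ∑ k ∈ Fintype.piFinset fun _ : Fin 3 => t, ∏ i, g (k i) :=
        Finset.sum_le_sum_of_subset_of_nonneg hst
          fun k _ _ => Finset.prod_nonneg fun i _ => hg _
    _ = (∑ n ∈ t, g n) ^ 3 := by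
        rw [← Finset.prod_univ_sum (fun _ : Fin 3 => t) (fun _ n => g n)]
        simp
    _ ≤ B ^ 3 := pow_le_pow_left₀ (Finset.sum_nonneg fun n _ => hg n) (hB t) 3

lemma sum_range_inv_sq_add_sq_le {R : ℝ} (hR : 1 ≤ R) (M : ℕ) :
    ∑ n ∈ Finset.range M, ((n : ℝ) ^ 2 + R ^ 2)⁻¹ ≤ 4 / R := by
  have h : ∑ n ∈ Finset.range M, ((n : ℝ) ^ 2 + R ^ 2)⁻¹ ≤ 4 / R - 4 / (M + R) := by
    induction M with
    | zero => simp
    | succ M ih =>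
      rw [Finset.sum_range_succ]
      have hM : (0 : ℝ) ≤ M := M.cast_nonneg
      have step : ((M : ℝ) ^ 2 + R ^ 2)⁻¹ ≤ 4 / (M + R) - 4 / (M + 1 + R) := by
        rw [div_sub_div _ _ (by positivity) (by positivity), inv_eq_one_div,
          div_le_div_iff₀ (by positivity) (by positivity)]
        nlinarith [sq_nonneg ((M : ℝ) - R)]
      push_cast
      linarith
  have : 0 ≤ 4 / ((M : ℝ) + R) := by positivity
  linarith

/-- The cube root of `max n 1`. -/
noncomputable def cbrtMax (n : ℕ) : ℝ := (max (n : ℝ) 1) ^ (1 / 3 : ℝ)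

lemma cbrtMax_pos (n : ℕ) : 0 < cbrtMax n := by unfold cbrtMax; positivity

lemma cbrtMax_cube (n : ℕ) : cbrtMax n ^ 3 = max (n : ℝ) 1 := by
  unfold cbrtMax
  rw [← Real.rpow_natCast, ← Real.rpow_mul (by positivity)]
  norm_num

lemma sum_range_inv_cbrtMax_sq_le (N : ℕ) :
    ∑ n ∈ Finset.range (N + 1), (cbrtMax n ^ 2)⁻¹ ≤ 4 * cbrtMax N := by
  suffices h : ∑ n ∈ Finset.range (N + 1), (cbrtMax n ^ 2)⁻¹ ≤ 3 * cbrtMax N + 1 by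
    have : 1 ≤ cbrtMax N := Real.one_le_rpow (le_max_right _ _) (by norm_num)
    linarith
  have h0 : cbrtMax 0 = 1 := by simp [cbrtMax]
  have h1 : cbrtMax 1 = 1 := by simp [cbrtMax]
  induction N with
  | zero => simp [h0]
  | succ N ih =>
    rw [Finset.sum_range_succ]
    rcases Nat.eq_zero_or_pos N with rfl | hN
    · simp only [zero_add, Finset.sum_range_one, h0, h1]
      norm_num
    have hx := cbrtMax_pos (N + 1)
    have hy := cbrtMax_pos N
    have hx3 := cbrtMax_cube (N + 1)
    have hy3 := cbrtMax_cube N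
    have hN' : (1 : ℝ) ≤ N := by exact_mod_cast hN
    rw [max_eq_left (by push_cast; linarith)] at hx3
    rw [max_eq_left hN'] at hy3
    push_cast at hx3
    set x := cbrtMax (N + 1)
    set y := cbrtMax N
    have hyx : y ≤ x := le_of_pow_le_pow_left₀ (by norm_num : 3 ≠ 0) hx.le (by linarith)
    have step : (x ^ 2)⁻¹ ≤ 3 * (x - y) := by
      rw [inv_le_iff_one_le_mul₀ (by positivity)]
      nlinarith [mul_nonneg (mul_nonneg (sub_nonneg.2 hyx) (sub_nonneg.2 hyx)) hx.le,
        mul_nonneg (mul_nonneg (sub_nonneg.2 hyx) (sub_nonneg.2 hyx)) hy.le]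
    linarith

/-- One-dimensional factor of the near-field majorant of `|m|⁻²` on `1 ≤ |m| ≤ R`. -/
noncomputable def nearFactor (R : ℝ) (n : ℕ) : ℝ :=
  if (n : ℝ) ≤ R then (cbrtMax n ^ 2)⁻¹ else 0

lemma nearFactor_nonneg (R : ℝ) (n : ℕ) : 0 ≤ nearFactor R n := by
  unfold nearFactor
  split_ifs <;> positivity

lemma sum_range_nearFactor_le {R : ℝ} (hR : 1 ≤ R) (M : ℕ) :
    ∑ n ∈ Finset.range M, nearFactor R n ≤ 4 * R ^ (1 / 3 : ℝ) := by
  have hle : cbrtMax ⌊R⌋₊ ≤ R ^ (1 / 3 : ℝ) :=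
    Real.rpow_le_rpow (by positivity) (max_le (Nat.floor_le (by linarith)) hR) (by norm_num)
  calc ∑ n ∈ Finset.range M, nearFactor R n
      = ∑ n ∈ (Finset.range M).filter (fun n : ℕ => (n : ℝ) ≤ R), (cbrtMax n ^ 2)⁻¹ :=
        (Finset.sum_filter _ _).symm
    _ ≤ ∑ n ∈ Finset.range (⌊R⌋₊ + 1), (cbrtMax n ^ 2)⁻¹ := by
        refine Finset.sum_le_sum_of_subset_of_nonneg (fun n hn => ?_)
          (fun n _ _ => by positivity)
        exact Finset.mem_range.2 (Nat.lt_succ_of_le (Nat.le_floor (Finset.mem_filter.1 hn).2))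
    _ ≤ 4 * cbrtMax ⌊R⌋₊ := sum_range_inv_cbrtMax_sq_le _
    _ ≤ 4 * R ^ (1 / 3 : ℝ) := by linarith

lemma sum_prod_nearFactor_le {R : ℝ} (hR : 1 ≤ R) (s : Finset Lat3) :
    ∑ m ∈ s, ∏ i, nearFactor R (m i).natAbs ≤ 512 * R := by
  have h := sum_prod_le_pow (g := fun n => nearFactor R n.natAbs)
    (fun n => nearFactor_nonneg R _)
    (sum_natAbs_le (nearFactor_nonneg R) (sum_range_nearFactor_le hR)) s
  have hc : (R ^ (1 / 3 : ℝ)) ^ 3 = R := by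
    rw [← Real.rpow_natCast, ← Real.rpow_mul (by positivity)]
    norm_num
  calc _ ≤ _ := h
    _ = 512 * (R ^ (1 / 3 : ℝ)) ^ 3 := by ring
    _ = 512 * R := by rw [hc]

lemma sum_prod_inv_sq_add_sq_le {R : ℝ} (hR : 1 ≤ R) (s : Finset Lat3) :
    ∑ k ∈ s, ∏ i, ((k i : ℝ) ^ 2 + R ^ 2)⁻¹ ≤ 512 / R ^ 3 := by
  have h := sum_prod_le_pow (g := fun n => (((n.natAbs : ℕ) : ℝ) ^ 2 + R ^ 2)⁻¹)
    (fun n => by positivity)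
    (sum_natAbs_le (g := fun n => ((n : ℝ) ^ 2 + R ^ 2)⁻¹)
      (fun n => by positivity) (sum_range_inv_sq_add_sq_le hR)) s
  simp only [Nat.cast_natAbs, Int.cast_abs, sq_abs] at h
  calc _ ≤ _ := h
    _ = 512 / R ^ 3 := by ring

/-- The Euclidean norm of an integer vector. -/
noncomputable def latNorm (k : Lat3) : ℝ := Real.sqrt (∑ i, ((k i : ℝ)) ^ 2)

lemma latNorm_sq (k : Lat3) : latNorm k ^ 2 = ∑ i, ((k i : ℝ)) ^ 2 :=
  Real.sq_sqrt (by positivity)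

lemma natAbs_le_latNorm (k : Lat3) (i : Fin 3) : ((k i).natAbs : ℝ) ≤ latNorm k := by
  rw [Nat.cast_natAbs, Int.cast_abs]
  exact Real.abs_le_sqrt
    (Finset.single_le_sum (f := fun i => ((k i : ℝ)) ^ 2) (fun i _ => sq_nonneg _)
      (Finset.mem_univ i))

lemma one_le_latNorm {k : Lat3} (hk : k ≠ 0) : 1 ≤ latNorm k := by
  obtain ⟨i, hi⟩ := Function.ne_iff.1 hk
  refine le_trans ?_ (natAbs_le_latNorm k i)
  exact_mod_cast Int.natAbs_pos.2 hi

lemma inv_latNorm_pow_six_le {R : ℝ} (hR : 1 ≤ R) {k : Lat3} (hk : R ≤ latNorm k) :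
    (latNorm k ^ 6)⁻¹ ≤ 8 * ∏ i, ((k i : ℝ) ^ 2 + R ^ 2)⁻¹ := by
  have h : ∏ i, ((k i : ℝ) ^ 2 + R ^ 2) ≤ ∏ _i : Fin 3, (2 * latNorm k ^ 2) := by
    refine Finset.prod_le_prod (fun i _ => by positivity) (fun i _ => ?_)
    have h1 : (k i : ℝ) ^ 2 ≤ latNorm k ^ 2 := by
      rw [latNorm_sq]
      exact Finset.single_le_sum (f := fun i => ((k i : ℝ)) ^ 2) (fun i _ => sq_nonneg _)
        (Finset.mem_univ i)
    have h2 : R ^ 2 ≤ latNorm k ^ 2 := pow_le_pow_left₀ (by linarith) hk 2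
    linarith
  have hpos : 0 < ∏ i, ((k i : ℝ) ^ 2 + R ^ 2) :=
    Finset.prod_pos fun i _ => by positivity
  have hk0 : 0 < latNorm k := by linarith
  rw [Finset.prod_inv_distrib, ← div_eq_mul_inv, inv_eq_one_div,
    div_le_div_iff₀ (by positivity) hpos]
  calc 1 * ∏ i, ((k i : ℝ) ^ 2 + R ^ 2) ≤ ∏ _i : Fin 3, (2 * latNorm k ^ 2) := by
        rwa [one_mul]
    _ = 8 * latNorm k ^ 6 := by
        simp only [Finset.prod_const, Finset.card_univ, Fintype.card_fin]
        ring

lemma inv_latNorm_sq_le {R : ℝ} {m : Lat3} (hm : m ≠ 0) (hmR : latNorm m ≤ R) :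
    (latNorm m ^ 2)⁻¹ ≤ ∏ i, nearFactor R (m i).natAbs := by
  have hm1 := one_le_latNorm hm
  have hle : ∏ i, cbrtMax (m i).natAbs ≤ latNorm m := by
    refine le_of_pow_le_pow_left₀ (by norm_num : 3 ≠ 0) (by linarith) ?_
    rw [← Finset.prod_pow]
    calc ∏ i, cbrtMax (m i).natAbs ^ 3 ≤ ∏ _i : Fin 3, latNorm m := by
          refine Finset.prod_le_prod (fun i _ => pow_nonneg (cbrtMax_pos _).le 3)
            (fun i _ => ?_)
          rw [cbrtMax_cube]
          exact max_le (natAbs_le_latNorm m i) hm1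
      _ = latNorm m ^ 3 := by simp
  have hpos : 0 < ∏ i, cbrtMax (m i).natAbs := Finset.prod_pos fun i _ => cbrtMax_pos _
  have heq : ∏ i, nearFactor R (m i).natAbs = ((∏ i, cbrtMax (m i).natAbs) ^ 2)⁻¹ := by
    rw [← Finset.prod_pow, ← Finset.prod_inv_distrib]
    refine Finset.prod_congr rfl fun i _ => ?_
    exact if_pos ((natAbs_le_latNorm m i).trans hmR)
  rw [heq]
  exact inv_anti₀ (by positivity) (pow_le_pow_left₀ hpos.le hle 2)

lemma inv_latNorm_mul_le {R : ℝ} (hR : 1 ≤ R) {k q : Lat3} (hk : R ≤ latNorm k)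
    (hkq : k ≠ q) :
    (latNorm k ^ 6)⁻¹ * (latNorm (q - k) ^ 2)⁻¹ ≤
      (R ^ 6)⁻¹ * ∏ i, nearFactor R ((q - k) i).natAbs +
        (R ^ 2)⁻¹ * (8 * ∏ i, ((k i : ℝ) ^ 2 + R ^ 2)⁻¹) := by
  have hR0 : 0 < R := by linarith
  have hnear : 0 ≤ ∏ i, nearFactor R ((q - k) i).natAbs :=
    Finset.prod_nonneg fun i _ => nearFactor_nonneg R _
  have hfar : 0 ≤ ∏ i, ((k i : ℝ) ^ 2 + R ^ 2)⁻¹ :=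
    Finset.prod_nonneg fun i _ => by positivity
  rcases le_total (latNorm (q - k)) R with h | h
  · refine le_add_of_le_of_nonneg ?_ (by positivity)
    exact mul_le_mul (inv_anti₀ (by positivity) (pow_le_pow_left₀ hR0.le hk 6))
      (inv_latNorm_sq_le (sub_ne_zero.2 hkq.symm) h) (by positivity) (by positivity)
  · refine le_add_of_nonneg_of_le (by positivity) ?_
    rw [mul_comm]
    exact mul_le_mul (inv_anti₀ (by positivity) (pow_le_pow_left₀ hR0.le h 2))
      (inv_latNorm_pow_six_le hR hk) (by positivity) (by positivity)

lemma sum_inv_latNorm_mul_le {R : ℝ} (hR : 1 ≤ R) (q : Lat3) (s : Finset Lat3)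
    (hs : ∀ k ∈ s, R ≤ latNorm k ∧ k ≠ q) :
    ∑ k ∈ s, (latNorm k ^ 6)⁻¹ * (latNorm (q - k) ^ 2)⁻¹ ≤ 4608 / R ^ 5 := by
  have hR0 : 0 < R := by linarith
  have hnear : ∑ k ∈ s, ∏ i, nearFactor R ((q - k) i).natAbs ≤ 512 * R := by
    rw [← Finset.sum_image (f := fun m : Lat3 => ∏ i, nearFactor R (m i).natAbs)
      (g := fun k => q - k) (fun x _ y _ h => sub_right_injective h)]
    exact sum_prod_nearFactor_le hR _
  calc _ ≤ ∑ k ∈ s, ((R ^ 6)⁻¹ * ∏ i, nearFactor R ((q - k) i).natAbs +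
        (R ^ 2)⁻¹ * (8 * ∏ i, ((k i : ℝ) ^ 2 + R ^ 2)⁻¹)) :=
        Finset.sum_le_sum fun k hk => inv_latNorm_mul_le hR (hs k hk).1 (hs k hk).2
    _ = (R ^ 6)⁻¹ * ∑ k ∈ s, ∏ i, nearFactor R ((q - k) i).natAbs +
        (R ^ 2)⁻¹ * (8 * ∑ k ∈ s, ∏ i, ((k i : ℝ) ^ 2 + R ^ 2)⁻¹) := by
        rw [Finset.sum_add_distrib, ← Finset.mul_sum, ← Finset.mul_sum, ← Finset.mul_sum]
    _ ≤ (R ^ 6)⁻¹ * (512 * R) + (R ^ 2)⁻¹ * (8 * (512 / R ^ 3)) := by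
        have := sum_prod_inv_sq_add_sq_le hR s
        gcongr
    _ = 4608 / R ^ 5 := by
        field_simp
        norm_num

/-- Key supremum estimate of the triple Lieb–Yamazaki bound: for `Λ > 1` and any
lattice point `q`, `Σ_{|k|≥Λ, k≠q} L^{-3}|k|^{-6}|q−k|^{-2} ≤ C Λ^{-5}` with `C`
independent of `L ≥ L₀`, `Λ` and `q`. -/
theorem lieb_yamazaki_sup_estimate :
    ∀ L₀ : ℝ, 0 < L₀ → ∃ C : ℝ, 0 < C ∧
      ∀ L : ℝ, L₀ ≤ L → ∀ Λ : ℝ, 1 < Λ → ∀ q : Lat3,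
        (∑' k : Lat3,
          if Λ ≤ knorm L k ∧ k ≠ q then
            (L ^ 3)⁻¹ / (knorm L k ^ 6 * knorm L (q - k) ^ 2)
          else 0) ≤ C / Λ ^ 5 := by
  intro L₀ hL₀
  refine ⟨4608, by norm_num, fun L hL Λ hΛ q => ?_⟩
  have hL0 : 0 < L := by linarith
  have hΛ0 : 0 < Λ := by linarith
  set h : ℝ := 2 * Real.pi / L with hh
  have hpos : 0 < h := by positivity
  have hLh : (L ^ 3)⁻¹ ≤ h ^ 3 := by
    rw [← inv_pow]
    refine pow_le_pow_left₀ (by positivity) ?_ 3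
    rw [hh, inv_eq_one_div]
    gcongr
    linarith [Real.pi_gt_three]
  have hknorm : ∀ k, knorm L k = h * latNorm k := fun k => rfl
  set R : ℝ := max (Λ / h) 1
  have hR : 1 ≤ R := le_max_right _ _
  have hΛR : Λ ≤ h * R := by
    rw [← div_le_iff₀' hpos]
    exact le_max_left _ _
  have hcond : ∀ k, Λ ≤ knorm L k → R ≤ latNorm k := by
    intro k hk
    rw [hknorm] at hk
    refine max_le ((div_le_iff₀' hpos).2 hk) (one_le_latNorm ?_)
    rintro rfl
    simp [latNorm] at hk
    linarith
  refine tsum_le_of_sum_le' (by positivity) fun s => ?_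
  rw [← Finset.sum_filter]
  have hterm : ∀ k, (L ^ 3)⁻¹ / (knorm L k ^ 6 * knorm L (q - k) ^ 2) ≤
      (h ^ 5)⁻¹ * ((latNorm k ^ 6)⁻¹ * (latNorm (q - k) ^ 2)⁻¹) := by
    intro k
    calc (L ^ 3)⁻¹ / (knorm L k ^ 6 * knorm L (q - k) ^ 2)
        ≤ h ^ 3 / (knorm L k ^ 6 * knorm L (q - k) ^ 2) := by gcongr
      _ = (h ^ 3 / h ^ 8) * ((latNorm k ^ 6)⁻¹ * (latNorm (q - k) ^ 2)⁻¹) := by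
          rw [hknorm, hknorm, div_eq_mul_inv, div_eq_mul_inv, ← mul_inv, mul_assoc, ← mul_inv]
          ring
      _ = _ := by
          congr 1
          field_simp
  calc _ ≤ ∑ k ∈ s with Λ ≤ knorm L k ∧ k ≠ q,
        (h ^ 5)⁻¹ * ((latNorm k ^ 6)⁻¹ * (latNorm (q - k) ^ 2)⁻¹) :=
        Finset.sum_le_sum fun k _ => hterm k
    _ ≤ (h ^ 5)⁻¹ * (4608 / R ^ 5) := by
        rw [← Finset.mul_sum]
        refine mul_le_mul_of_nonneg_left (sum_inv_latNorm_mul_le hR q _ fun k hk => ?_)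
          (by positivity)
        have hk' := (Finset.mem_filter.1 hk).2
        exact ⟨hcond k hk'.1, hk'.2⟩
    _ = 4608 / (h * R) ^ 5 := by
        rw [mul_pow]
        field_simp
    _ ≤ 4608 / Λ ^ 5 := by gcongr
end
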